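/- arXiv:math/0609799 — 2 statements merged into one kernel-verified Lean document; each statement's English description precedes it below -/
import Mathlib

section
/- Let p ≥ 1 and A, n, r_1, …, r_p ≥ 0 be integers, and let ξ ∈ ℂ* satisfy ξ^p = 1. Let K = ℚ(ξ) and let P ∈ K[k_1, …, k_p] satisfy condition (9) (with A_i = A, n_i = n for all i) and the cyclic symmetry P(K_2, K_3, …, K_p, K_1) = ξ · P(K_1, …, K_p), where K_i = k_i + r_i + n/2. Then the series Σ_{k_1 ≥ … ≥ k_p ≥ 1} P(k_1, …, k_p) / ((k_1+r_1)_{n+1}^A ⋯ (k_p+r_p)_{n+1}^A) is a K-linear combination of multiple zeta values of depth at most p whose depth-p part is a K-linear combination of the cyclic sums Σ_{i=1}^p ξ^{i−1} ζ(s_i, s_{i+1}, …, s_p, s_1, s_2, …, s_{i−1}) with s_1, …, s_p ≥ 2. -/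
/-- The multiple zeta value `ζ(s₁, …, s_q)`, defined as a sum over strictly
decreasing tuples `k₁ > k₂ > … > k_q ≥ 1`.  For the empty list it equals `1`. -/
noncomputable def mzv (s : List ℕ) : ℝ :=
  ∑' k : {k : Fin s.length → ℕ // StrictAnti k ∧ ∀ i, 1 ≤ k i},
    ∏ i : Fin s.length, ((k.1 i : ℝ) ^ s.get i)⁻¹

/-- The rational function `P(k₁,…,k_p) / ∏ᵢ ((kᵢ+rᵢ)_{nᵢ+1})^{Aᵢ}`. -/
noncomputable def Rfun (p : ℕ) (K : Subfield ℂ) (A n r : ℕ → ℕ)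
    (P : MvPolynomial (Fin p) K) (k : Fin p → ℂ) : ℂ :=
  MvPolynomial.eval₂ K.subtype k P /
    ∏ i : Fin p, ((ascPochhammer ℂ (n i.1 + 1)).eval (k i + (r i.1 : ℂ))) ^ A i.1

noncomputable section

open Finset Filter Topology

/-- The function `m ↦ (m + 1 + a)^(-s)`. -/
def invPow (a s : ℕ) : ℕ → ℂ := fun m => (((m + 1 + a : ℕ) : ℂ) ^ s)⁻¹

/-- The forward difference operator on sequences. -/
def seqDiff (K : Subfield ℂ) : (ℕ → ℂ) →ₗ[K] (ℕ → ℂ) where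
  toFun g := fun m => g (m + 1) - g m
  map_add' f g := by ext m; simp only [Pi.add_apply]; ring
  map_smul' c g := by ext m; simp only [Pi.smul_apply, smul_sub, RingHom.id_apply]

/-- The span of the simple fractions `(m + 1 + a)^(-s)` with `s ≥ 1`. -/
def simpleFractions (K : Subfield ℂ) : Submodule K (ℕ → ℂ) :=
  Submodule.span K {f | ∃ a s, 1 ≤ s ∧ f = invPow a s}

/-- The span of the functions `(m + 1)^(-s)` with `s ≥ 2`. -/
def zetaTerms (K : Subfield ℂ) : Submodule K (ℕ → ℂ) :=
  Submodule.span K {f | ∃ s, 2 ≤ s ∧ f = invPow 0 s}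

/-- The combinations of simple fractions that decay at least quadratically. -/
def quadFractions (K : Subfield ℂ) : Submodule K (ℕ → ℂ) :=
  zetaTerms K ⊔ (simpleFractions K).map (seqDiff K)

variable {K : Subfield ℂ}

theorem seqDiff_apply (g : ℕ → ℂ) (m : ℕ) : seqDiff K g m = g (m + 1) - g m := rfl

theorem invPow_mem_simpleFractions (a : ℕ) {s : ℕ} (hs : 1 ≤ s) :
    invPow a s ∈ simpleFractions K :=
  Submodule.subset_span ⟨a, s, hs, rfl⟩

theorem invPow_mem_zetaTerms {s : ℕ} (hs : 2 ≤ s) : invPow 0 s ∈ zetaTerms K :=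
  Submodule.subset_span ⟨s, hs, rfl⟩

theorem invPow_shift (a s r m : ℕ) : invPow a s (m + r) = invPow (a + r) s m := by
  simp only [invPow]
  congr 3
  ring

theorem invPow_mul_invPow (a s t : ℕ) : invPow a s * invPow a t = invPow a (s + t) := by
  ext m
  simp only [invPow, Pi.mul_apply, pow_add, mul_inv]

theorem shift_mem_simpleFractions (r : ℕ) {g : ℕ → ℂ} (hg : g ∈ simpleFractions K) :
    (fun m => g (m + r)) ∈ simpleFractions K := by
  refine Submodule.span_le (p := (simpleFractions K).comap
    (LinearMap.funLeft K ℂ (fun m => m + r))) |>.2 ?_ hg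
  rintro _ ⟨a, s, hs, rfl⟩
  have : (LinearMap.funLeft K ℂ (fun m => m + r)) (invPow a s) = invPow (a + r) s := by
    ext m; exact invPow_shift a s r m
  simpa [this] using invPow_mem_simpleFractions (a + r) hs

theorem seqDiff_mem_simpleFractions {g : ℕ → ℂ} (hg : g ∈ simpleFractions K) :
    seqDiff K g ∈ simpleFractions K :=
  Submodule.sub_mem _ (shift_mem_simpleFractions 1 hg) hg

theorem zetaTerms_le_simpleFractions : zetaTerms K ≤ simpleFractions K := by
  refine Submodule.span_le.2 ?_
  rintro _ ⟨s, hs, rfl⟩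
  exact invPow_mem_simpleFractions 0 (by omega)

theorem quadFractions_le_simpleFractions : quadFractions K ≤ simpleFractions K := by
  refine sup_le zetaTerms_le_simpleFractions ?_
  rintro _ ⟨g, hg, rfl⟩
  exact seqDiff_mem_simpleFractions hg

theorem zetaTerms_le_quadFractions : zetaTerms K ≤ quadFractions K := le_sup_left

theorem seqDiff_mem_quadFractions {g : ℕ → ℂ} (hg : g ∈ simpleFractions K) :
    seqDiff K g ∈ quadFractions K :=
  le_sup_right (a := zetaTerms K) (Submodule.mem_map_of_mem hg)

/-- A shift of a simple fraction changes it by a difference. -/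
theorem exists_shift_sub_eq_seqDiff (r : ℕ) {g : ℕ → ℂ} (hg : g ∈ simpleFractions K) :
    ∃ h ∈ simpleFractions K, (fun m => g (m + r)) = g + seqDiff K h := by
  induction r with
  | zero => exact ⟨0, Submodule.zero_mem _, by simp⟩
  | succ r ih =>
    obtain ⟨h, hh, e⟩ := ih
    refine ⟨h + fun m => g (m + r),
      Submodule.add_mem _ hh (shift_mem_simpleFractions r hg), ?_⟩
    ext m
    have := congrFun e m
    simp only [Pi.add_apply, seqDiff_apply] at this ⊢
    rw [show m + (r + 1) = m + 1 + r by ring]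
    linear_combination this

theorem invPow_mem_quadFractions (a : ℕ) {s : ℕ} (hs : 2 ≤ s) :
    invPow a s ∈ quadFractions K := by
  obtain ⟨h, hh, e⟩ := exists_shift_sub_eq_seqDiff (K := K) a
    (invPow_mem_simpleFractions 0 (show 1 ≤ s by omega))
  have : invPow a s = invPow 0 s + seqDiff K h := by
    rw [← e]; ext m; rw [invPow_shift, zero_add]
  rw [this]
  exact Submodule.add_mem _ (zetaTerms_le_quadFractions (invPow_mem_zetaTerms hs))
    (seqDiff_mem_quadFractions hh)

theorem invPow_one_sub_mem_quadFractions (a b : ℕ) :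
    invPow a 1 - invPow b 1 ∈ quadFractions K := by
  have key (a : ℕ) : ∃ h ∈ simpleFractions K, invPow a 1 = invPow 0 1 + seqDiff K h := by
    obtain ⟨h, hh, e⟩ := exists_shift_sub_eq_seqDiff (K := K) a
      (invPow_mem_simpleFractions 0 le_rfl)
    exact ⟨h, hh, by rw [← e]; ext m; rw [invPow_shift, zero_add]⟩
  obtain ⟨g, hg, eg⟩ := key a
  obtain ⟨h, hh, eh⟩ := key b
  rw [eg, eh, add_sub_add_left_eq_sub, ← map_sub]
  exact seqDiff_mem_quadFractions (Submodule.sub_mem _ hg hh)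

theorem invPow_mul_invPow_succ {a b : ℕ} (hab : a ≠ b) (s t : ℕ) :
    invPow a (s + 1) * invPow b (t + 1) =
      ((b : K) - a)⁻¹ • (invPow a (s + 1) * invPow b t - invPow a s * invPow b (t + 1)) := by
  ext m
  have ha : ((m + 1 + a : ℕ) : ℂ) ≠ 0 := by norm_cast; omega
  have hb : ((m + 1 + b : ℕ) : ℂ) ≠ 0 := by norm_cast; omega
  have hba : (b : ℂ) - a ≠ 0 := sub_ne_zero.2 (by exact_mod_cast hab.symm)
  simp only [invPow, Pi.mul_apply, Pi.smul_apply, Pi.sub_apply, Subfield.smul_def, smul_eq_mul,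
    Subfield.coe_inv, Subfield.coe_sub, SubringClass.coe_natCast]
  field_simp
  push_cast
  ring

theorem invPow_mul_invPow_mem (a b s t : ℕ) (hst : 2 ≤ s + t) :
    invPow a s * invPow b t ∈ quadFractions K := by
  by_cases hab : a = b
  · subst hab
    rw [invPow_mul_invPow]
    exact invPow_mem_quadFractions a hst
  · have h0 (a : ℕ) : invPow a 0 = 1 := by ext m; simp [invPow]
    suffices ∀ d s t : ℕ, s + t = d → 2 ≤ s + t → invPow a s * invPow b t ∈ quadFractions K from
      this _ s t rfl hst
    clear hst s t
    intro d
    induction d with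
    | zero => intro s t h1 h2; omega
    | succ d ih =>
      intro s t h1 h2
      rcases s with _ | s
      · rw [h0, one_mul]; exact invPow_mem_quadFractions b (by omega)
      rcases t with _ | t
      · rw [h0, mul_one]; exact invPow_mem_quadFractions a (by omega)
      rw [invPow_mul_invPow_succ (K := K) hab]
      refine Submodule.smul_mem _ _ ?_
      by_cases hst : s + t = 0
      · obtain ⟨rfl, rfl⟩ : s = 0 ∧ t = 0 := by omega
        simpa [h0] using invPow_one_sub_mem_quadFractions a b
      · exact Submodule.sub_mem _ (ih _ _ (by omega) (by omega)) (ih _ _ (by omega) (by omega))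

theorem mul_mem_quadFractions {f g : ℕ → ℂ} (hf : f ∈ simpleFractions K)
    (hg : g ∈ simpleFractions K) : f * g ∈ quadFractions K := by
  refine LinearMap.BilinMap.apply_apply_mem_of_mem_span (quadFractions K) _ _
    (LinearMap.mul K (ℕ → ℂ)) ?_ f g hf hg
  rintro _ ⟨a, s, hs, rfl⟩ _ ⟨b, t, ht, rfl⟩
  exact invPow_mul_invPow_mem a b s t (by omega)

theorem mul_mem_zetaTerms {f g : ℕ → ℂ} (hf : f ∈ zetaTerms K)
    (hg : g ∈ zetaTerms K) : f * g ∈ zetaTerms K := by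
  refine LinearMap.BilinMap.apply_apply_mem_of_mem_span (zetaTerms K) _ _
    (LinearMap.mul K (ℕ → ℂ)) ?_ f g hf hg
  rintro _ ⟨s, hs, rfl⟩ _ ⟨t, ht, rfl⟩
  rw [LinearMap.mul_apply', invPow_mul_invPow]
  exact invPow_mem_zetaTerms (by omega)

theorem prod_invPow_mem_simpleFractions (L : Multiset ℕ) (hL : L ≠ 0) :
    (L.map fun b => invPow b 1).prod ∈ simpleFractions K := by
  induction L using Multiset.induction with
  | empty => exact absurd rfl hL
  | cons b L ih =>
    rw [Multiset.map_cons, Multiset.prod_cons]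
    by_cases h : L = 0
    · simpa [h] using invPow_mem_simpleFractions b le_rfl
    · exact quadFractions_le_simpleFractions
        (mul_mem_quadFractions (invPow_mem_simpleFractions b le_rfl) (ih h))

/-- A rational function whose poles are negative integers and whose degree is at most `-2` is a
quadratically decaying combination of simple fractions. -/
theorem pow_mul_prod_invPow_mem (c : K) (e : ℕ) (L : Multiset ℕ) (h : e + 2 ≤ L.card) :
    (fun m : ℕ => ((m : ℂ) + 1 + c) ^ e) * (L.map fun b => invPow b 1).prod ∈
      quadFractions K := by
  induction e generalizing L with
  | zero =>
    obtain ⟨b, hb⟩ := Multiset.card_pos_iff_exists_mem.1 (show 0 < L.card by omega)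
    obtain ⟨L, rfl⟩ := Multiset.exists_cons_of_mem hb
    have hL : L ≠ 0 := by rintro rfl; simp at h
    have h1 : (fun m : ℕ => ((m : ℂ) + 1 + c) ^ 0) = 1 := by ext; simp
    rw [h1, one_mul, Multiset.map_cons, Multiset.prod_cons]
    exact mul_mem_quadFractions (invPow_mem_simpleFractions b le_rfl)
      (prod_invPow_mem_simpleFractions L hL)
  | succ e ih =>
    obtain ⟨b, hb⟩ := Multiset.card_pos_iff_exists_mem.1 (show 0 < L.card by omega)
    obtain ⟨L, rfl⟩ := Multiset.exists_cons_of_mem hb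
    rw [Multiset.card_cons] at h
    have key := Submodule.add_mem _ (ih L (by omega))
      (Submodule.smul_mem _ (c - b) (ih (b ::ₘ L) (by rw [Multiset.card_cons]; omega)))
    convert key using 1
    ext m
    have hm : ((m + 1 + b : ℕ) : ℂ) ≠ 0 := by norm_cast; omega
    simp only [Multiset.map_cons, Multiset.prod_cons, Pi.mul_apply, Pi.add_apply, Pi.smul_apply,
      Subfield.smul_def, smul_eq_mul, Subfield.coe_sub, SubringClass.coe_natCast, invPow]
    field_simp
    push_cast
    ring

theorem tendsto_invPow (a : ℕ) {s : ℕ} (hs : 1 ≤ s) :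
    Filter.Tendsto (invPow a s) Filter.atTop (nhds 0) := by
  have h := (tendsto_inv_atTop_nhds_zero_nat (𝕜 := ℂ)).comp
    (Filter.tendsto_add_atTop_nat (1 + a))
  have h2 := h.pow s
  rw [zero_pow (by omega)] at h2
  refine h2.congr fun m => ?_
  simp [invPow, add_assoc]

theorem tendsto_of_mem_simpleFractions {g : ℕ → ℂ} (hg : g ∈ simpleFractions K) :
    Filter.Tendsto g Filter.atTop (nhds 0) := by
  induction hg using Submodule.span_induction with
  | mem f hf => obtain ⟨a, s, hs, rfl⟩ := hf; exact tendsto_invPow a hs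
  | zero => exact tendsto_const_nhds
  | add f g _ _ hf hg => rw [← add_zero (0 : ℂ)]; exact hf.add hg
  | smul c f _ hf => rw [← mul_zero (c : ℂ)]; exact hf.const_mul (c : ℂ)

theorem summable_norm_seqDiff_invPow (a s : ℕ) :
    Summable fun m => ‖seqDiff K (invPow a s) m‖ := by
  have hn (m : ℕ) : ‖seqDiff K (invPow a s) m‖ =
      (((m + 1 + a : ℕ) : ℝ) ^ s)⁻¹ - (((m + 1 + 1 + a : ℕ) : ℝ) ^ s)⁻¹ := by
    rw [seqDiff_apply, ← norm_neg, neg_sub]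
    have : invPow a s m - invPow a s (m + 1) =
        (((((m + 1 + a : ℕ) : ℝ) ^ s)⁻¹ - (((m + 1 + 1 + a : ℕ) : ℝ) ^ s)⁻¹ : ℝ) : ℂ) := by
      simp [invPow]
    rw [this, Complex.norm_real, Real.norm_of_nonneg]
    rw [sub_nonneg]
    gcongr
    omega
  refine summable_of_sum_range_le (c := (((0 + 1 + a : ℕ) : ℝ) ^ s)⁻¹)
    (fun m => norm_nonneg _) fun N => ?_
  simp_rw [hn]
  rw [Finset.sum_range_sub' (fun m => (((m + 1 + a : ℕ) : ℝ) ^ s)⁻¹)]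
  have : 0 ≤ (((N + 1 + a : ℕ) : ℝ) ^ s)⁻¹ := by positivity
  linarith

theorem summable_norm_invPow {s : ℕ} (hs : 2 ≤ s) : Summable fun m => ‖invPow 0 s m‖ := by
  have := (summable_nat_add_iff 1).2 (Real.summable_nat_pow_inv.2 (show 1 < s by omega))
  refine this.congr fun m => ?_
  simp only [invPow, norm_inv, norm_pow, Complex.norm_natCast, add_zero]

theorem summable_norm_of_mem_span {S : Set (ℕ → ℂ)} (hS : ∀ f ∈ S, Summable fun m => ‖f m‖)
    {f : ℕ → ℂ} (hf : f ∈ Submodule.span K S) : Summable fun m => ‖f m‖ := by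
  induction hf using Submodule.span_induction with
  | mem f hf => exact hS f hf
  | zero => simp
  | add f g _ _ hf hg =>
    exact (hf.add hg).of_nonneg_of_le (fun _ => norm_nonneg _) fun m => norm_add_le (f m) (g m)
  | smul c f _ hf => simpa [Subfield.smul_def] using hf.mul_left ‖(c : ℂ)‖

theorem summable_norm_of_mem_quadFractions {f : ℕ → ℂ} (hf : f ∈ quadFractions K) :
    Summable fun m => ‖f m‖ := by
  rw [quadFractions, zetaTerms, simpleFractions, Submodule.map_span, ← Submodule.span_union] at hf
  refine summable_norm_of_mem_span ?_ hf
  rintro _ (⟨s, hs, rfl⟩ | ⟨_, ⟨a, s, hs, rfl⟩, rfl⟩)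
  · exact summable_norm_invPow hs
  · exact summable_norm_seqDiff_invPow a s

/-- One step of an iterated sum: `D` is replaced by `N ↦ ∑_{m < N} f m * D (m + d)`. -/
def nestedStep (K : Subfield ℂ) (d : ℕ) : (ℕ → ℂ) →ₗ[K] (ℕ → ℂ) →ₗ[K] (ℕ → ℂ) :=
  LinearMap.mk₂ K (fun f D N => ∑ m ∈ range N, f m * D (m + d))
    (fun f g D => by ext N; simp [add_mul, sum_add_distrib])
    (fun c f D => by ext N; simp [Subfield.smul_def, mul_sum, mul_assoc])
    (fun f D E => by ext N; simp [mul_add, sum_add_distrib])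
    (fun c f D => by ext N; simp [Subfield.smul_def, mul_sum, mul_left_comm])

/-- The iterated sum of `∏ f_i (m_i)` over `N > m_1`, `m_1 + d > m_2`, `m_2 + d > m_3`, ….
It is strict for `d = 0` and weak for `d = 1`. -/
def nestedSum (d : ℕ) : List (ℕ → ℂ) → ℕ → ℂ
  | [] => 1
  | f :: L => fun N => ∑ m ∈ range N, f m * nestedSum d L (m + d)

theorem nestedStep_apply (d : ℕ) (f D : ℕ → ℂ) (N : ℕ) :
    nestedStep K d f D N = ∑ m ∈ range N, f m * D (m + d) := rfl

theorem nestedStep_nestedSum (d : ℕ) (f : ℕ → ℂ) (L : List (ℕ → ℂ)) :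
    nestedStep K d f (nestedSum d L) = nestedSum d (f :: L) := rfl

theorem nestedSum_nil (d : ℕ) : nestedSum d [] = 1 := rfl

theorem nestedSum_cons_apply (d : ℕ) (f : ℕ → ℂ) (L : List (ℕ → ℂ)) (N : ℕ) :
    nestedSum d (f :: L) N = ∑ m ∈ range N, f m * nestedSum d L (m + d) := rfl

theorem nestedSum_seqDiff_singleton (g : ℕ → ℂ) :
    nestedSum 1 [seqDiff K g] = g - fun _ => g 0 := by
  ext N
  simp only [nestedSum_cons_apply, nestedSum_nil, Pi.one_apply, mul_one, seqDiff_apply,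
    sum_range_sub, Pi.sub_apply]

theorem nestedSum_seqDiff_cons (g h : ℕ → ℂ) (L : List (ℕ → ℂ)) :
    nestedSum 1 (seqDiff K g :: h :: L) =
      g * nestedSum 1 (h :: L) - nestedSum 1 ((g * h) :: L) := by
  ext N
  induction N with
  | zero => simp [nestedSum_cons_apply]
  | succ N ih =>
    rw [nestedSum_cons_apply, sum_range_succ, ← nestedSum_cons_apply, ih]
    simp only [Pi.sub_apply, Pi.mul_apply, seqDiff_apply]
    rw [nestedSum_cons_apply 1 h L (N + 1), nestedSum_cons_apply 1 (g * h) L (N + 1),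
      sum_range_succ, sum_range_succ, ← nestedSum_cons_apply, ← nestedSum_cons_apply]
    simp only [Pi.mul_apply]
    ring

theorem nestedStep_one_nestedSum_zero (u v : ℕ → ℂ) (L : List (ℕ → ℂ)) :
    nestedStep K 1 u (nestedSum 0 (v :: L)) =
      nestedSum 0 (u :: v :: L) + nestedSum 0 ((u * v) :: L) := by
  ext N
  simp only [nestedStep_apply, Pi.add_apply, nestedSum_cons_apply, sum_range_succ, mul_add,
    sum_add_distrib, add_zero, Pi.mul_apply, mul_assoc]

/-- The span of weak nested sums of depth less than `q`, possibly multiplied by a combination of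
simple fractions of the summation bound. -/
def weakSpan (K : Subfield ℂ) (q : ℕ) : Submodule K (ℕ → ℂ) :=
  Submodule.span K
    ({D | ∃ L : List (ℕ → ℂ), L.length < q ∧ (∀ f ∈ L, f ∈ quadFractions K) ∧
        D = nestedSum 1 L} ∪
      {D | ∃ g ∈ simpleFractions K, ∃ L : List (ℕ → ℂ), L.length < q ∧
        (∀ f ∈ L, f ∈ quadFractions K) ∧ D = g * nestedSum 1 L})

/-- The span of strict nested sums of depth less than `q` whose terms are combinations of
`(m + 1)^(-s)` with `s ≥ 2`. -/
def strictSpan (K : Subfield ℂ) (q : ℕ) : Submodule K (ℕ → ℂ) :=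
  Submodule.span K {D | ∃ L : List (ℕ → ℂ), L.length < q ∧ (∀ f ∈ L, f ∈ zetaTerms K) ∧
    D = nestedSum 0 L}

theorem nestedSum_one_mem_weakSpan {q : ℕ} {L : List (ℕ → ℂ)} (hq : L.length < q)
    (hL : ∀ f ∈ L, f ∈ quadFractions K) : nestedSum 1 L ∈ weakSpan K q :=
  Submodule.subset_span (Or.inl ⟨L, hq, hL, rfl⟩)

theorem mul_nestedSum_one_mem_weakSpan {q : ℕ} {g : ℕ → ℂ} (hg : g ∈ simpleFractions K)
    {L : List (ℕ → ℂ)} (hq : L.length < q) (hL : ∀ f ∈ L, f ∈ quadFractions K) :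
    g * nestedSum 1 L ∈ weakSpan K q :=
  Submodule.subset_span (Or.inr ⟨g, hg, L, hq, hL, rfl⟩)

theorem nestedSum_zero_mem_strictSpan {q : ℕ} {L : List (ℕ → ℂ)} (hq : L.length < q)
    (hL : ∀ f ∈ L, f ∈ zetaTerms K) : nestedSum 0 L ∈ strictSpan K q :=
  Submodule.subset_span ⟨L, hq, hL, rfl⟩

theorem nestedStep_mem_weakSpan {q : ℕ} {u D : ℕ → ℂ} (hu : u ∈ quadFractions K)
    (hD : D ∈ weakSpan K q) : nestedStep K 1 u D ∈ weakSpan K (q + 1) := by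
  refine Submodule.span_le (p := (weakSpan K (q + 1)).comap (nestedStep K 1 u)) |>.2 ?_ hD
  rintro _ (⟨L, hq, hL, rfl⟩ | ⟨g, hg, L, hq, hL, rfl⟩)
  · refine nestedSum_one_mem_weakSpan (L := u :: L) (by simpa using hq) ?_
    simpa [hu] using hL
  · have : nestedStep K 1 u (g * nestedSum 1 L) =
        nestedSum 1 ((u * fun m => g (m + 1)) :: L) := by
      ext N
      simp only [nestedStep_apply, nestedSum_cons_apply, Pi.mul_apply, mul_assoc]
    rw [SetLike.mem_coe, Submodule.mem_comap, this]
    refine nestedSum_one_mem_weakSpan (by simpa using hq) ?_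
    simpa [mul_mem_quadFractions (quadFractions_le_simpleFractions hu)
      (shift_mem_simpleFractions 1 hg)] using hL

theorem exists_eq_of_mem_simpleFractions {g : ℕ → ℂ} (hg : g ∈ simpleFractions K) (m : ℕ) :
    ∃ c : K, (c : ℂ) = g m := by
  induction hg using Submodule.span_induction with
  | mem f hf =>
    obtain ⟨a, s, hs, rfl⟩ := hf
    exact ⟨(((m + 1 + a : ℕ) : K) ^ s)⁻¹, by simp [invPow]⟩
  | zero => exact ⟨0, rfl⟩
  | add f g _ _ hf hg =>
    obtain ⟨a, ha⟩ := hf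
    obtain ⟨b, hb⟩ := hg
    exact ⟨a + b, by simp [ha, hb]⟩
  | smul c f _ hf =>
    obtain ⟨a, ha⟩ := hf
    exact ⟨c * a, by simp [ha, Subfield.smul_def]⟩

theorem nestedSum_seqDiff_mem_weakSpan {g : ℕ → ℂ} (hg : g ∈ simpleFractions K)
    {L : List (ℕ → ℂ)} (hL : ∀ f ∈ L, f ∈ quadFractions K) :
    nestedSum 1 (seqDiff K g :: L) ∈ weakSpan K (L.length + 1) := by
  rcases L with _ | ⟨h, L⟩
  · obtain ⟨c, hc⟩ := exists_eq_of_mem_simpleFractions hg 0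
    have : nestedSum 1 [seqDiff K g] = g * nestedSum 1 [] - c • nestedSum 1 [] := by
      rw [nestedSum_seqDiff_singleton]
      ext N
      simp [nestedSum_nil, Subfield.smul_def, hc]
    rw [this]
    exact Submodule.sub_mem _ (mul_nestedSum_one_mem_weakSpan hg (by simp) hL)
      (Submodule.smul_mem _ _ (nestedSum_one_mem_weakSpan (by simp) hL))
  · rw [nestedSum_seqDiff_cons]
    refine Submodule.sub_mem _ (mul_nestedSum_one_mem_weakSpan hg (by simp) hL)
      (nestedSum_one_mem_weakSpan (by simp) ?_)
    rw [List.forall_mem_cons] at hL ⊢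
    exact ⟨mul_mem_quadFractions hg (quadFractions_le_simpleFractions hL.1), hL.2⟩

/-- `u` is the combination of `(m + 1)^(-s)`, `s ≥ 2`, that agrees with `f` up to the difference of
a combination of simple fractions. -/
def IsZetaPart (K : Subfield ℂ) (f u : ℕ → ℂ) : Prop :=
  u ∈ zetaTerms K ∧ ∃ g ∈ simpleFractions K, f = u + seqDiff K g

theorem IsZetaPart.mem_quadFractions {f u : ℕ → ℂ} (h : IsZetaPart K f u) :
    f ∈ quadFractions K := by
  obtain ⟨hu, g, hg, rfl⟩ := h
  exact Submodule.add_mem _ (zetaTerms_le_quadFractions hu) (seqDiff_mem_quadFractions hg)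

theorem exists_isZetaPart {f : ℕ → ℂ} (hf : f ∈ quadFractions K) : ∃ u, IsZetaPart K f u := by
  obtain ⟨u, hu, _, ⟨g, hg, rfl⟩, rfl⟩ := Submodule.mem_sup.1 hf
  exact ⟨u, hu, g, hg, rfl⟩

theorem IsZetaPart.shift {f u : ℕ → ℂ} (h : IsZetaPart K f u) (r : ℕ) :
    IsZetaPart K (fun m => f (m + r)) u := by
  obtain ⟨a, ha, e⟩ := exists_shift_sub_eq_seqDiff r
    (quadFractions_le_simpleFractions h.mem_quadFractions)
  obtain ⟨hu, g, hg, rfl⟩ := h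
  exact ⟨hu, g + a, Submodule.add_mem _ hg ha, by rw [e, map_add, add_assoc]⟩

theorem nestedSum_one_sub_mem_weakSpan {L U : List (ℕ → ℂ)}
    (h : List.Forall₂ (IsZetaPart K) L U) :
    nestedSum 1 L - nestedSum 1 U ∈ weakSpan K L.length := by
  induction h with
  | nil => simp
  | @cons f u L U hfu hLU ih =>
    have hL : ∀ f ∈ L, f ∈ quadFractions K := by
      intro f hf
      obtain ⟨i, hi, rfl⟩ := List.mem_iff_getElem.1 hf
      exact (List.Forall₂.get hLU hi (hLU.length_eq ▸ hi)).mem_quadFractions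
    obtain ⟨hu, g, hg, rfl⟩ := hfu
    have : nestedSum 1 ((u + seqDiff K g) :: L) - nestedSum 1 (u :: U) =
        nestedSum 1 (seqDiff K g :: L) + nestedStep K 1 u (nestedSum 1 L - nestedSum 1 U) := by
      rw [← nestedStep_nestedSum (K := K), map_add, LinearMap.add_apply, map_sub]
      simp only [nestedStep_nestedSum]
      abel
    rw [this, List.length_cons]
    exact Submodule.add_mem _ (nestedSum_seqDiff_mem_weakSpan hg hL)
      (nestedStep_mem_weakSpan (zetaTerms_le_quadFractions hu) ih)

theorem nestedStep_sub_mem_strictSpan {u : ℕ → ℂ} (hu : u ∈ zetaTerms K) {L : List (ℕ → ℂ)}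
    (hL : ∀ f ∈ L, f ∈ zetaTerms K) :
    nestedStep K 1 u (nestedSum 0 L) - nestedSum 0 (u :: L) ∈ strictSpan K (L.length + 1) := by
  rcases L with _ | ⟨v, L⟩
  · have : nestedStep K 1 u (nestedSum 0 []) = nestedSum 0 [u] := rfl
    rw [this, sub_self]
    exact Submodule.zero_mem _
  · rw [nestedStep_one_nestedSum_zero, add_sub_cancel_left]
    rw [List.forall_mem_cons] at hL
    refine nestedSum_zero_mem_strictSpan (by simp) ?_
    rw [List.forall_mem_cons]
    exact ⟨mul_mem_zetaTerms hu hL.1, hL.2⟩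

theorem strictSpan_mono {q q' : ℕ} (h : q ≤ q') : strictSpan K q ≤ strictSpan K q' := by
  refine Submodule.span_mono ?_
  rintro _ ⟨L, hq, hL, rfl⟩
  exact ⟨L, hq.trans_le h, hL, rfl⟩

theorem nestedStep_mem_strictSpan {q : ℕ} {u D : ℕ → ℂ} (hu : u ∈ zetaTerms K)
    (hD : D ∈ strictSpan K q) : nestedStep K 1 u D ∈ strictSpan K (q + 1) := by
  refine Submodule.span_le (p := (strictSpan K (q + 1)).comap (nestedStep K 1 u)) |>.2 ?_ hD
  rintro _ ⟨L, hq, hL, rfl⟩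
  rw [SetLike.mem_coe, Submodule.mem_comap, ← sub_add_cancel (nestedStep K 1 u (nestedSum 0 L))
    (nestedSum 0 (u :: L))]
  refine Submodule.add_mem _
    (strictSpan_mono (by omega) (nestedStep_sub_mem_strictSpan hu hL))
    (nestedSum_zero_mem_strictSpan (by simpa using hq) ?_)
  rw [List.forall_mem_cons]
  exact ⟨hu, hL⟩

theorem nestedSum_one_sub_nestedSum_zero_mem {U : List (ℕ → ℂ)} (hU : ∀ u ∈ U, u ∈ zetaTerms K) :
    nestedSum 1 U - nestedSum 0 U ∈ strictSpan K U.length := by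
  induction U with
  | nil => simp [nestedSum_nil]
  | cons u U ih =>
    rw [List.forall_mem_cons] at hU
    have : nestedSum 1 (u :: U) - nestedSum 0 (u :: U) =
        nestedStep K 1 u (nestedSum 1 U - nestedSum 0 U) +
          (nestedStep K 1 u (nestedSum 0 U) - nestedSum 0 (u :: U)) := by
      rw [map_sub, nestedStep_nestedSum]
      abel
    rw [this]
    exact Submodule.add_mem _ (nestedStep_mem_strictSpan hU.1 (ih hU.2))
      (nestedStep_sub_mem_strictSpan hU.1 hU.2)

theorem nestedSum_zero_mem_span {U : List (ℕ → ℂ)} (hU : ∀ u ∈ U, u ∈ zetaTerms K) :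
    nestedSum 0 U ∈ Submodule.span K {D | ∃ s : List ℕ, s.length = U.length ∧
      (∀ a ∈ s, 2 ≤ a) ∧ D = nestedSum 0 (s.map (invPow 0))} := by
  induction U with
  | nil => exact Submodule.subset_span ⟨[], rfl, by simp, rfl⟩
  | cons u U ih =>
    rw [List.forall_mem_cons] at hU
    rw [← nestedStep_nestedSum (K := K)]
    refine LinearMap.BilinMap.apply_apply_mem_of_mem_span _ _ _ (nestedStep K 0) ?_ _ _
      hU.1 (ih hU.2)
    rintro _ ⟨a, ha, rfl⟩ _ ⟨s, hs, hs2, rfl⟩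
    refine Submodule.subset_span ⟨a :: s, by simp [hs], ?_, rfl⟩
    rw [List.forall_mem_cons]
    exact ⟨ha, hs2⟩

/-- Strictly decreasing tuples for `d = 0` and weakly decreasing tuples for `d = 1`. -/
def IsNested (d : ℕ) {p : ℕ} (k : Fin p → ℕ) : Prop := ∀ i j, i < j → k j < k i + d

theorem isNested_zero {p : ℕ} (k : Fin p → ℕ) : IsNested 0 k ↔ StrictAnti k := Iff.rfl

theorem isNested_one {p : ℕ} (k : Fin p → ℕ) : IsNested 1 k ↔ Antitone k := by
  simp only [IsNested, antitone_iff_forall_lt, Nat.lt_succ_iff]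

theorem isNested_add_one {d p : ℕ} (k : Fin p → ℕ) :
    IsNested d (fun i => k i + 1) ↔ IsNested d k := by
  refine forall₃_congr fun i j _ => ?_
  rw [add_right_comm, add_lt_add_iff_right]

theorem isNested_cons {d p m : ℕ} (k : Fin p → ℕ) :
    IsNested d (Fin.cons m k : Fin (p + 1) → ℕ) ↔ (∀ i, k i < m + d) ∧ IsNested d k := by
  constructor
  · refine fun h => ⟨fun i => ?_, fun i j hij => ?_⟩
    · simpa using h 0 i.succ (Fin.succ_pos i)
    · simpa using h i.succ j.succ (Fin.succ_lt_succ_iff.2 hij)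
  · rintro ⟨h0, h⟩ i j hij
    obtain ⟨j, rfl⟩ := Fin.exists_succ_eq.2 (Fin.ne_zero_of_lt hij)
    induction i using Fin.cases with
    | zero => simpa using h0 j
    | succ i => simpa using h i j (Fin.succ_lt_succ_iff.1 hij)

open Classical in
theorem nestedSum_ofFn {d : ℕ} (hd : d ≤ 1) {p : ℕ} (f : Fin p → ℕ → ℂ) (N : ℕ) :
    nestedSum d (List.ofFn f) N =
      ∑ k ∈ Fintype.piFinset fun _ => range N with IsNested d k, ∏ i, f i (k i) := by
  induction p generalizing N with
  | zero =>
    have : (Fintype.piFinset fun _ : Fin 0 => range N) = {default} := by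
      ext k
      simp only [Fintype.mem_piFinset, mem_singleton, IsEmpty.forall_iff, true_iff]
      exact Subsingleton.elim _ _
    rw [this, filter_true_of_mem (fun k _ i => i.elim0)]
    simp [nestedSum_nil]
  | succ p ih =>
    rw [List.ofFn_succ, nestedSum_cons_apply]
    simp_rw [ih, mul_sum]
    rw [sum_sigma']
    refine sum_bij' (fun x _ => (Fin.cons x.1 x.2 : Fin (p + 1) → ℕ))
      (fun k _ => ⟨k 0, Fin.tail k⟩) ?_ ?_ ?_ ?_ ?_
    · rintro ⟨m, k⟩ h
      simp only [mem_sigma, mem_filter, Fintype.mem_piFinset, mem_range] at h ⊢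
      refine ⟨fun i => ?_, (isNested_cons k).2 h.2⟩
      induction i using Fin.cases with
      | zero => exact h.1
      | succ i =>
        have := h.2.1 i
        simp only [Fin.cons_succ]
        omega
    · intro k h
      rw [mem_filter, ← Fin.cons_self_tail k, isNested_cons] at h
      simp only [mem_sigma, mem_filter, Fintype.mem_piFinset, mem_range] at h ⊢
      exact ⟨h.1 0, h.2⟩
    · rintro ⟨m, k⟩ _
      simp
    · intro k _
      simp
    · rintro ⟨m, k⟩ _
      simp [Fin.prod_univ_succ]

theorem summable_prod_pi {p : ℕ} (f : Fin p → ℕ → ℂ) (hf : ∀ i, Summable fun m => ‖f i m‖) :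
    Summable fun m : Fin p → ℕ => ∏ i, f i (m i) := by
  refine Summable.of_norm ?_
  refine summable_of_sum_le (c := ∏ i, ∑' m, ‖f i m‖) (fun m => norm_nonneg _) fun t => ?_
  calc ∑ m ∈ t, ‖∏ i, f i (m i)‖
      ≤ ∑ m ∈ Fintype.piFinset fun i => t.image fun m => m i, ‖∏ i, f i (m i)‖ := by
        refine sum_le_sum_of_subset_of_nonneg (fun m hm => ?_) fun _ _ _ => norm_nonneg _
        exact Fintype.mem_piFinset.2 fun i => mem_image_of_mem _ hm
    _ = ∏ i, ∑ m ∈ t.image fun m => m i, ‖f i m‖ := by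
        rw [prod_univ_sum]
        simp_rw [norm_prod]
    _ ≤ ∏ i, ∑' m, ‖f i m‖ := by
        gcongr with i
        exact (hf i).sum_le_tsum _ fun _ _ => norm_nonneg _

open Classical in
/-- A summable function on tuples of positive integers may be summed over the nested tuples by
letting a common bound on the entries grow. -/
theorem summable_and_tendsto_nested {d p : ℕ} {T : (Fin p → ℕ) → Prop}
    (hT : ∀ k, IsNested d k ↔ T k) (G : (Fin p → ℕ) → ℂ)
    (hG : Summable fun m : Fin p → ℕ => G fun i => m i + 1) :
    Summable (fun k : {k : Fin p → ℕ // T k ∧ ∀ i, 1 ≤ k i} => G k.1) ∧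
    Tendsto (fun N => ∑ m ∈ Fintype.piFinset fun _ => range N with IsNested d m,
      G fun i => m i + 1) atTop (𝓝 (∑' k : {k : Fin p → ℕ // T k ∧ ∀ i, 1 ≤ k i}, G k.1)) := by
  let e : {m : Fin p → ℕ // m ∈ {m | IsNested d m}} ≃
      {k : Fin p → ℕ // T k ∧ ∀ i, 1 ≤ k i} :=
    { toFun := fun m => ⟨fun i => m.1 i + 1, (hT _).1 ((isNested_add_one _).2 m.2),
        fun i => Nat.le_add_left _ _⟩
      invFun := fun k => ⟨fun i => k.1 i - 1, (isNested_add_one _).1 <| by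
        have : (fun i => k.1 i - 1 + 1) = k.1 := funext fun i => Nat.sub_add_cancel (k.2.2 i)
        rw [this]
        exact (hT _).2 k.2.1⟩
      left_inv := fun m => by ext i; simp
      right_inv := fun k => by ext i; exact Nat.sub_add_cancel (k.2.2 i) }
  have hs := hG.subtype {m | IsNested d m}
  refine ⟨(e.summable_iff (f := fun k : {k : Fin p → ℕ // T k ∧ ∀ i, 1 ≤ k i} => G k.1)).1 hs,
    ?_⟩
  have ht : HasSum ({m | IsNested d m}.indicator fun m : Fin p → ℕ => G fun i => m i + 1)
      (∑' k : {k : Fin p → ℕ // T k ∧ ∀ i, 1 ≤ k i}, G k.1) := by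
    rw [← hasSum_subtype_iff_indicator, ← e.tsum_eq]
    exact hs.hasSum
  have hfin : Tendsto (fun N => Fintype.piFinset fun _ : Fin p => range N) atTop atTop := by
    refine tendsto_atTop_finset_of_monotone (fun N M h => ?_) fun m => ?_
    · exact Fintype.piFinset_subset _ _ fun _ => range_mono h
    · refine ⟨∑ i, m i + 1, Fintype.mem_piFinset.2 fun i => mem_range.2 (Nat.lt_succ_iff.2 ?_)⟩
      exact single_le_sum (f := m) (fun _ _ => Nat.zero_le _) (mem_univ i)
  refine (ht.comp hfin).congr fun N => ?_
  simp only [Function.comp_def, sum_filter, Set.indicator_apply, Set.mem_ofPred_eq]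

theorem tendsto_nestedSum_invPow {s : List ℕ} (hs : ∀ a ∈ s, 2 ≤ a) :
    Tendsto (nestedSum 0 (s.map (invPow 0))) atTop (𝓝 (mzv s : ℂ)) := by
  have hl : s.map (invPow 0) = List.ofFn fun i => invPow 0 (s.get i) := by
    conv_lhs => rw [← List.ofFn_get s, List.map_ofFn]
    rfl
  have hsum := summable_prod_pi (fun i => invPow 0 (s.get i))
    fun i => summable_norm_invPow (hs _ (s.get_mem i))
  have h := (summable_and_tendsto_nested isNested_zero
    (fun k => ∏ i : Fin s.length, ((k i : ℂ) ^ s.get i)⁻¹) hsum).2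
  have hm : (mzv s : ℂ) = ∑' k : {k : Fin s.length → ℕ // StrictAnti k ∧ ∀ i, 1 ≤ k i},
      ∏ i : Fin s.length, ((k.1 i : ℂ) ^ s.get i)⁻¹ := by
    rw [mzv, Complex.ofReal_tsum]
    push_cast
    rfl
  rw [hm]
  refine h.congr fun N => ?_
  rw [hl, nestedSum_ofFn zero_le_one]
  rfl

/-- The span of the multiple zeta values of depth less than `q` with all exponents at least `2`. -/
def mzvSpan (K : Subfield ℂ) (q : ℕ) : Submodule K ℂ :=
  Submodule.span K {z | ∃ s : List ℕ, (s.length < q ∧ ∀ a ∈ s, 2 ≤ a) ∧ (mzv s : ℂ) = z}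

/-- The sequences converging to an element of `mzvSpan K q`. -/
def limSpan (K : Subfield ℂ) (q : ℕ) : Submodule K (ℕ → ℂ) where
  carrier := {D | ∃ l ∈ mzvSpan K q, Tendsto D atTop (𝓝 l)}
  add_mem' := by
    rintro _ _ ⟨l, hl, h⟩ ⟨l', hl', h'⟩
    exact ⟨l + l', Submodule.add_mem _ hl hl', h.add h'⟩
  zero_mem' := ⟨0, Submodule.zero_mem _, tendsto_const_nhds⟩
  smul_mem' := by
    rintro c _ ⟨l, hl, h⟩
    exact ⟨c • l, Submodule.smul_mem _ c hl, h.const_mul (c : ℂ)⟩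

theorem limSpan_mono {q q' : ℕ} (h : q ≤ q') : limSpan K q ≤ limSpan K q' := by
  rintro D ⟨l, hl, hD⟩
  refine ⟨l, Submodule.span_mono ?_ hl, hD⟩
  rintro _ ⟨s, ⟨hs, hs2⟩, rfl⟩
  exact ⟨s, ⟨hs.trans_le h, hs2⟩, rfl⟩

theorem strictSpan_le_limSpan (q : ℕ) : strictSpan K q ≤ limSpan K q := by
  refine Submodule.span_le.2 ?_
  rintro _ ⟨U, hq, hU, rfl⟩
  refine Submodule.span_le.2 ?_ (nestedSum_zero_mem_span hU)
  rintro _ ⟨s, hs, hs2, rfl⟩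
  exact ⟨mzv s, Submodule.subset_span ⟨s, ⟨hs ▸ hq, hs2⟩, rfl⟩, tendsto_nestedSum_invPow hs2⟩

theorem weakSpan_le_limSpan (q : ℕ) : weakSpan K q ≤ limSpan K q := by
  induction q using Nat.strong_induction_on with
  | _ q ih =>
    have key {L : List (ℕ → ℂ)} (hq : L.length < q) (hL : ∀ f ∈ L, f ∈ quadFractions K) :
        nestedSum 1 L ∈ limSpan K q := by
      choose! u hu using fun f (hf : f ∈ quadFractions K) => exists_isZetaPart hf
      have h2 : List.Forall₂ (IsZetaPart K) L (L.map u) := by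
        rw [List.forall₂_map_right_iff, List.forall₂_same]
        exact fun f hf => hu f (hL f hf)
      have hU : ∀ v ∈ L.map u, v ∈ zetaTerms K := by
        simp only [List.mem_map]
        rintro _ ⟨f, hf, rfl⟩
        exact (hu f (hL f hf)).1
      have h3 := limSpan_mono hq.le (ih _ hq (nestedSum_one_sub_mem_weakSpan h2))
      have h4 := strictSpan_le_limSpan _ (strictSpan_mono (K := K) (q' := q) (by simpa using hq.le)
        (nestedSum_one_sub_nestedSum_zero_mem hU))
      have h5 := strictSpan_le_limSpan _
        (nestedSum_zero_mem_strictSpan (q := q) (by simpa using hq) hU)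
      simpa using Submodule.add_mem _ h3 (Submodule.add_mem _ h4 h5)
    refine Submodule.span_le.2 ?_
    rintro _ (⟨L, hq, hL, rfl⟩ | ⟨g, hg, L, hq, hL, rfl⟩)
    · exact key hq hL
    · obtain ⟨l, -, hl⟩ := key hq hL
      refine ⟨0, Submodule.zero_mem _, ?_⟩
      rw [← zero_mul l]
      exact (tendsto_of_mem_simpleFractions hg).mul hl

/-- Replacing the terms of a weak nested sum by their zeta parts and making the sum strict changes
it only by values of smaller depth. -/
theorem nestedSum_sub_mem_limSpan {p : ℕ} {f u : Fin p → ℕ → ℂ}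
    (h : ∀ i, IsZetaPart K (f i) (u i)) :
    nestedSum 1 (List.ofFn f) - nestedSum 0 (List.ofFn u) ∈ limSpan K p := by
  have h2 : List.Forall₂ (IsZetaPart K) (List.ofFn f) (List.ofFn u) := by
    rw [List.forall₂_iff_get]
    refine ⟨by simp, fun i h1 h2 => ?_⟩
    simpa using h _
  have hU : ∀ v ∈ List.ofFn u, v ∈ zetaTerms K := by
    simp only [List.mem_ofFn]
    rintro _ ⟨i, rfl⟩
    exact (h i).1
  have h3 := weakSpan_le_limSpan _ (nestedSum_one_sub_mem_weakSpan h2)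
  have h4 := strictSpan_le_limSpan _ (nestedSum_one_sub_nestedSum_zero_mem hU)
  rw [List.length_ofFn] at h3 h4
  simpa using Submodule.add_mem _ h3 h4

theorem tendsto_nestedSum_ofFn_sum {p : ℕ} (I : Fin p → Finset ℕ) (hI : ∀ i, ∀ a ∈ I i, 2 ≤ a)
    (c : Fin p → ℕ → K) :
    Tendsto (nestedSum 0 (List.ofFn fun i => ∑ a ∈ I i, c i a • invPow 0 a)) atTop
      (𝓝 (∑ s ∈ Fintype.piFinset I, ((∏ i, c i (s i) : K) : ℂ) * (mzv (List.ofFn s) : ℂ))) := by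
  classical
  have h : Tendsto (fun N => ∑ s ∈ Fintype.piFinset I,
      ((∏ i, c i (s i) : K) : ℂ) * nestedSum 0 ((List.ofFn s).map (invPow 0)) N) atTop
      (𝓝 (∑ s ∈ Fintype.piFinset I, ((∏ i, c i (s i) : K) : ℂ) * (mzv (List.ofFn s) : ℂ))) := by
    refine tendsto_finsetSum _ fun s hs => (tendsto_nestedSum_invPow ?_).const_mul _
    simp only [List.mem_ofFn]
    rintro _ ⟨i, rfl⟩
    exact hI i _ (Fintype.mem_piFinset.1 hs i)
  refine h.congr fun N => ?_
  rw [nestedSum_ofFn zero_le_one]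
  simp_rw [List.map_ofFn, nestedSum_ofFn zero_le_one, mul_sum]
  rw [sum_comm]
  refine sum_congr rfl fun k _ => ?_
  simp only [Finset.sum_apply, Pi.smul_apply, Subfield.smul_def, smul_eq_mul]
  rw [prod_univ_sum]
  refine sum_congr rfl fun s _ => ?_
  rw [prod_mul_distrib, Function.comp_def]
  push_cast
  rfl

theorem exists_finsupp_isZetaPart {f : ℕ → ℂ} (hf : f ∈ quadFractions K) :
    ∃ c : ℕ →₀ K, (∀ a ∈ c.support, 2 ≤ a) ∧
      IsZetaPart K f (∑ a ∈ c.support, c a • invPow 0 a) := by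
  obtain ⟨u, hu⟩ := exists_isZetaPart hf
  have h1 : zetaTerms K = Submodule.span K (invPow 0 '' {s | 2 ≤ s}) := by
    rw [zetaTerms]
    congr 1
    ext f
    exact exists_congr fun s => and_congr_right fun _ => eq_comm
  have h2 := hu.1
  rw [h1, Finsupp.mem_span_image_iff_linearCombination] at h2
  obtain ⟨c, hc, rfl⟩ := h2
  exact ⟨c, fun a ha => (Finsupp.mem_supported K c).1 hc ha, hu⟩

theorem exists_finset_of_mem_mzvSpan {q : ℕ} {z : ℂ} (hz : z ∈ mzvSpan K q) :
    ∃ (T : Finset (List ℕ)) (c : List ℕ → K), (∀ s ∈ T, s.length < q ∧ ∀ a ∈ s, 2 ≤ a) ∧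
      z = ∑ s ∈ T, (c s : ℂ) * (mzv s : ℂ) := by
  obtain ⟨c, hc, rfl⟩ := (Finsupp.mem_span_image_iff_linearCombination K
    (v := fun s : List ℕ => (mzv s : ℂ)) (s := {s | s.length < q ∧ ∀ a ∈ s, 2 ≤ a})).1 hz
  exact ⟨c.support, c, fun s hs => (Finsupp.mem_supported K c).1 hc hs, rfl⟩

/-- The function `m ↦ (m + 1 + n / 2)^e / (m + 1)_{n + 1}^A`. -/
def centeredTerm (A n e : ℕ) : ℕ → ℂ := fun m =>
  ((m : ℂ) + 1 + n / 2) ^ e / ((ascPochhammer ℂ (n + 1)).eval ((m : ℂ) + 1)) ^ A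

theorem ascPochhammer_eval_eq_prod (n : ℕ) (x : ℂ) :
    (ascPochhammer ℂ n).eval x = ∏ j ∈ range n, (x + j) := by
  induction n with
  | zero => simp
  | succ n ih => rw [ascPochhammer_succ_eval, ih, prod_range_succ]

theorem centeredTerm_mem_quadFractions {A n e : ℕ} (h : e + 2 ≤ A * (n + 1)) :
    centeredTerm A n e ∈ quadFractions K := by
  convert pow_mul_prod_invPow_mem ((n : K) / 2) e (A • Multiset.range (n + 1)) (by simpa using h)
    using 1
  ext m
  have h2 : ∀ m, ((Multiset.range (n + 1)).map fun b => invPow b 1).prod m =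
      ((ascPochhammer ℂ (n + 1)).eval ((m : ℂ) + 1))⁻¹ := by
    intro m
    rw [ascPochhammer_eval_eq_prod, ← prod_inv_distrib]
    change (∏ b ∈ range (n + 1), invPow b 1) m = _
    rw [Finset.prod_apply]
    simp [invPow]
  rw [Multiset.map_nsmul, Multiset.prod_nsmul, Pi.mul_apply, Pi.pow_apply, h2, centeredTerm,
    inv_pow, div_eq_mul_inv]
  congr 3

/-- The polynomial `P` rewritten in the translated variables `k_i + a_i`. -/
def translateVars {p : ℕ} (a : Fin p → K) (P : MvPolynomial (Fin p) K) : MvPolynomial (Fin p) K :=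
  MvPolynomial.bind₁ (fun i => MvPolynomial.X i - MvPolynomial.C (a i)) P

theorem eval₂_translateVars {p : ℕ} (a : Fin p → K) (P : MvPolynomial (Fin p) K) (x : Fin p → ℂ) :
    MvPolynomial.eval₂ K.subtype x (translateVars a P) =
      MvPolynomial.eval₂ K.subtype (fun i => x i - a i) P := by
  have := MvPolynomial.eval₂Hom_bind₁ K.subtype x
    (fun i => MvPolynomial.X i - MvPolynomial.C (a i)) P
  simpa [translateVars] using this

theorem degreeOf_translateVars_le {p : ℕ} (a : Fin p → K) (P : MvPolynomial (Fin p) K) (i : Fin p) :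
    (translateVars a P).degreeOf i ≤ P.degreeOf i := by
  rw [translateVars, MvPolynomial.bind₁, MvPolynomial.aeval_def, MvPolynomial.eval₂_eq']
  refine (MvPolynomial.degreeOf_sum_le _ _ _).trans (Finset.sup_le fun d hd => ?_)
  refine (MvPolynomial.degreeOf_C_mul_le _ _ _).trans ?_
  refine (MvPolynomial.degreeOf_prod_le _ _ _).trans ?_
  have (j : Fin p) : MvPolynomial.degreeOf i
      ((MvPolynomial.X j - MvPolynomial.C (a j) : MvPolynomial (Fin p) K) ^ d j) ≤
      if i = j then d i else 0 := by
    refine (MvPolynomial.degreeOf_pow_le _ _ _).trans ?_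
    have h := MvPolynomial.degreeOf_sub_le i (MvPolynomial.X j : MvPolynomial (Fin p) K)
      (MvPolynomial.C (a j))
    rw [MvPolynomial.degreeOf_C, MvPolynomial.degreeOf_X] at h
    split_ifs at h ⊢ with hij
    · subst hij
      exact (Nat.mul_le_mul_left _ h).trans (by simp)
    · exact (Nat.mul_le_mul_left _ h).trans (by simp)
  refine (sum_le_sum fun j _ => this j).trans ?_
  rw [sum_ite_eq]
  simpa using MvPolynomial.monomial_le_degreeOf i hd

theorem eq_of_eval₂_eq {p : ℕ} {P Q : MvPolynomial (Fin p) K}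
    (h : ∀ x : Fin p → ℂ, MvPolynomial.eval₂ K.subtype x P = MvPolynomial.eval₂ K.subtype x Q) :
    P = Q := by
  refine MvPolynomial.map_injective K.subtype K.subtype_injective (MvPolynomial.funext fun x => ?_)
  simpa only [MvPolynomial.eval_map] using h x

theorem rename_translateVars_eq {p : ℕ} {a : Fin p → K} {P : MvPolynomial (Fin p) K}
    {σ : Fin p → Fin p} {ξ : K}
    (h : ∀ k : Fin p → ℂ, MvPolynomial.eval₂ K.subtype (fun i => k (σ i) + a (σ i) - a i) P =
      ξ * MvPolynomial.eval₂ K.subtype k P) :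
    MvPolynomial.rename σ (translateVars a P) = MvPolynomial.C ξ * translateVars a P := by
  refine eq_of_eval₂_eq fun x => ?_
  have := h fun i => x i - a i
  simpa [MvPolynomial.eval₂_rename, eval₂_translateVars] using this

theorem degreeOf_eq_of_rename_eq {p : ℕ} (hp : 0 < p) {Q : MvPolynomial (Fin p) K} {ξ : K}
    (hξ : ξ ≠ 0) (h : MvPolynomial.rename (finRotate p) Q = MvPolynomial.C ξ * Q) (i : Fin p) :
    Q.degreeOf i = Q.degreeOf ⟨0, hp⟩ := by
  have hstep (i : Fin p) : Q.degreeOf (finRotate p i) = Q.degreeOf i := by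
    rw [← MvPolynomial.degreeOf_rename_of_injective (finRotate p).injective i, h,
      MvPolynomial.degreeOf_C_mul _ _ (mem_nonZeroDivisors_of_ne_zero hξ)]
  obtain ⟨p, rfl⟩ := Nat.exists_eq_succ_of_ne_zero hp.ne'
  induction i using Fin.induction with
  | zero => rfl
  | succ i ih =>
    rw [← ih, ← hstep i.castSucc, finRotate_apply, Fin.coeSucc_eq_succ]

/-- Cyclic symmetry of a polynomial passes to the weights obtained by substituting
`c (e i) (s i)` for the `i`-th variable to the power `e i`. -/
theorem sum_coeff_mul_prod_comp {p : ℕ} {Q : MvPolynomial (Fin p) K} {ξ : K} (hξ : ξ ≠ 0)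
    {σ : Equiv.Perm (Fin p)} (h : MvPolynomial.rename σ Q = MvPolynomial.C ξ * Q)
    (c : ℕ → ℕ → K) (s : Fin p → ℕ) :
    ∑ e ∈ Q.support, Q.coeff e * ∏ i, c (e i) (s (σ i)) =
      ξ * ∑ e ∈ Q.support, Q.coeff e * ∏ i, c (e i) (s i) := by
  have hcoeff (e : Fin p →₀ ℕ) : Q.coeff e = ξ * Q.coeff (e.equivMapDomain σ) := by
    rw [Finsupp.equivMapDomain_eq_mapDomain, ← MvPolynomial.coeff_C_mul, ← h,
      MvPolynomial.coeff_rename_mapDomain σ σ.injective]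
  rw [mul_sum]
  refine sum_equiv (Finsupp.equivCongrLeft σ) (fun e => ?_) fun e _ => ?_
  · rw [MvPolynomial.mem_support_iff, MvPolynomial.mem_support_iff, hcoeff e]
    simp [hξ]
  · rw [hcoeff e, mul_assoc]
    congr 2
    rw [← Equiv.prod_comp σ fun i => c (Finsupp.equivCongrLeft σ e i) (s i)]
    simp

/-- The translation `r_i + n / 2` that centers the `i`-th Pochhammer symbol at the origin. -/
def centerShift (K : Subfield ℂ) (p n : ℕ) (r : ℕ → ℕ) : Fin p → K :=
  fun i => (r i : K) + (n : K) / 2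

theorem coe_centerShift (p n : ℕ) (r : ℕ → ℕ) (i : Fin p) :
    (centerShift K p n r i : ℂ) = r i + n / 2 := by
  simp only [centerShift, Subfield.coe_add, Subfield.coe_div, SubringClass.coe_natCast]
  rfl

theorem Rfun_eq_sum {p A n : ℕ} (r : ℕ → ℕ) (P : MvPolynomial (Fin p) K) (m : Fin p → ℕ) :
    Rfun p K (fun _ => A) (fun _ => n) r P (fun i => ((m i + 1 : ℕ) : ℂ)) =
      ∑ e ∈ (translateVars (centerShift K p n r) P).support,
        ((translateVars (centerShift K p n r) P).coeff e : K) *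
          ∏ i, centeredTerm A n (e i) (m i + r i) := by
  have h := eval₂_translateVars (centerShift K p n r) P
    (fun i => ((m i + 1 : ℕ) : ℂ) + centerShift K p n r i)
  simp only [add_sub_cancel_right] at h
  rw [MvPolynomial.eval₂_eq'] at h
  rw [Rfun, ← h, sum_div]
  refine sum_congr rfl fun e _ => ?_
  rw [mul_div_assoc, ← prod_div_distrib]
  congr 1
  refine prod_congr rfl fun i _ => ?_
  simp only [centeredTerm, coe_centerShift]
  push_cast
  ring_nf

open Classical in
theorem tendsto_sum_nested_prod {p : ℕ} (ι : Finset (Fin p →₀ ℕ)) (q : (Fin p →₀ ℕ) → K)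
    (f : Fin p → ℕ → ℕ → ℂ) (I : Finset ℕ) (hI : ∀ a ∈ I, 2 ≤ a) (c : ℕ → ℕ → K)
    (hf : ∀ e ∈ ι, ∀ i, IsZetaPart K (f i (e i)) (∑ a ∈ I, c (e i) a • invPow 0 a)) :
    ∃ z ∈ mzvSpan K p, Tendsto (fun N => ∑ m ∈ Fintype.piFinset fun _ => range N with IsNested 1 m,
        ∑ e ∈ ι, (q e : ℂ) * ∏ i, f i (e i) (m i)) atTop
      (𝓝 (z + ∑ s ∈ Fintype.piFinset fun _ => I,
        ((∑ e ∈ ι, q e * ∏ i, c (e i) (s i) : K) : ℂ) * (mzv (List.ofFn s) : ℂ))) := by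
  choose! z hz hlim using fun e he => nestedSum_sub_mem_limSpan (hf e he)
  refine ⟨∑ e ∈ ι, q e • z e,
    Submodule.sum_mem _ fun e he => Submodule.smul_mem _ _ (hz e he), ?_⟩
  have h := tendsto_finsetSum ι fun e he => ((hlim e he).add (tendsto_nestedSum_ofFn_sum
    (fun _ => I) (fun _ => hI) (fun i => c (e i)))).const_mul (q e : ℂ)
  convert h using 2 with N
  · rw [sum_comm]
    refine sum_congr rfl fun e _ => ?_
    rw [Pi.sub_apply, sub_add_cancel, nestedSum_ofFn le_rfl, mul_sum]
  · simp_rw [mul_add, sum_add_distrib, Subfield.smul_def, smul_eq_mul, mul_sum]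
    congr 1
    rw [sum_comm]
    refine sum_congr rfl fun s _ => ?_
    push_cast
    rw [sum_mul]
    exact sum_congr rfl fun e _ => mul_assoc _ _ _

/-- A sum over all tuples with a weight that is cyclically symmetric up to the factor `ξ` is a
combination of cyclic sums. -/
theorem sum_eq_sum_cyclic {p : ℕ} (hp : 0 < p) (I : Finset ℕ) {ξ : K} (C : (Fin p → ℕ) → K)
    (hC : ∀ s, C (s ∘ finRotate p) = ξ * C s) (Z : (Fin p → ℕ) → ℂ) :
    ∑ s ∈ Fintype.piFinset fun _ => I, (C s : ℂ) * Z s =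
      ∑ s ∈ Fintype.piFinset fun _ => I, ((C s / p : K) : ℂ) *
        ∑ t ∈ range p, (ξ : ℂ) ^ t * Z fun j => s ((finRotate p ^ t) j) := by
  have hpow (t : ℕ) (s : Fin p → ℕ) : C (s ∘ ⇑(finRotate p ^ t)) = ξ ^ t * C s := by
    induction t with
    | zero => simp
    | succ t ih =>
      rw [pow_succ, Equiv.Perm.coe_mul, ← Function.comp_assoc, hC, ih, pow_succ']
      ring
  have hsum (t : ℕ) : ∑ s ∈ Fintype.piFinset fun _ => I,
      (C s : ℂ) * ((ξ : ℂ) ^ t * Z fun j => s ((finRotate p ^ t) j)) =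
        ∑ s ∈ Fintype.piFinset fun _ => I, (C s : ℂ) * Z s := by
    refine sum_equiv ((finRotate p ^ t).arrowCongr (Equiv.refl ℕ)).symm (fun s => ?_)
      fun s _ => ?_
    · simp only [Fintype.mem_piFinset]
      exact ((finRotate p ^ t).forall_congr_right (q := fun i => s i ∈ I)).symm
    · have h1 : ((finRotate p ^ t).arrowCongr (Equiv.refl ℕ)).symm s =
          s ∘ ⇑(finRotate p ^ t) := rfl
      rw [h1, hpow]
      push_cast
      rw [← mul_assoc, mul_comm (C s : ℂ)]
      rfl
  simp_rw [mul_sum]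
  rw [sum_comm]
  have hp' : (p : ℂ) ≠ 0 := by exact_mod_cast hp.ne'
  simp_rw [Subfield.coe_div, SubringClass.coe_natCast, div_mul_eq_mul_div, ← sum_div, hsum,
    sum_const, card_range, nsmul_eq_mul]
  field_simp

theorem summable_and_exists_cyclic {p : ℕ} (hp : 0 < p) {A n : ℕ} (r : ℕ → ℕ) {ξ : K} (hξ : ξ ≠ 0)
    {Q : MvPolynomial (Fin p) K} (hdeg : ∀ i, Q.degreeOf i + 2 ≤ A * (n + 1))
    (hQ : MvPolynomial.rename (finRotate p) Q = MvPolynomial.C ξ * Q) (R : (Fin p → ℕ) → ℂ)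
    (hR : ∀ m : Fin p → ℕ, R (fun i => m i + 1) =
      ∑ e ∈ Q.support, (Q.coeff e : K) * ∏ i, centeredTerm A n (e i) (m i + r i)) :
    Summable (fun k : {k : Fin p → ℕ // Antitone k ∧ ∀ i, 1 ≤ k i} => R k.1) ∧
    ∃ z ∈ mzvSpan K p, ∃ (I : Finset ℕ) (μ : (Fin p → ℕ) → K), (∀ a ∈ I, 2 ≤ a) ∧
      ∑' k : {k : Fin p → ℕ // Antitone k ∧ ∀ i, 1 ≤ k i}, R k.1 =
        z + ∑ s ∈ Fintype.piFinset fun _ => I, (μ s : ℂ) *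
          ∑ t ∈ range p, (ξ : ℂ) ^ t *
            (mzv (List.ofFn fun j => s ((finRotate p ^ t) j)) : ℂ) := by
  have hexp {e : Fin p →₀ ℕ} (he : e ∈ Q.support) (i : Fin p) : e i + 2 ≤ A * (n + 1) :=
    (Nat.add_le_add_right (MvPolynomial.monomial_le_degreeOf i he) 2).trans (hdeg i)
  choose! c hc2 hc using fun e (he : e + 2 ≤ A * (n + 1)) =>
    exists_finsupp_isZetaPart (K := K) (centeredTerm_mem_quadFractions he)
  have hsum : Summable fun m : Fin p → ℕ => R fun i => m i + 1 := by
    simp_rw [hR]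
    refine summable_sum fun e he => Summable.mul_left _ ?_
    exact summable_prod_pi (fun i m => centeredTerm A n (e i) (m + r i)) fun i =>
      summable_norm_of_mem_quadFractions ((hc _ (hexp he i)).shift (r i)).mem_quadFractions
  obtain ⟨hs, ht⟩ := summable_and_tendsto_nested isNested_one R hsum
  refine ⟨hs, ?_⟩
  let I := (range (A * (n + 1) - 1)).biUnion fun e => (c e).support
  have hI : ∀ a ∈ I, 2 ≤ a := by
    intro a ha
    obtain ⟨e, he, ha⟩ := mem_biUnion.1 ha
    rw [mem_range] at he
    exact hc2 e (by omega) a ha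
  have hf : ∀ e ∈ Q.support, ∀ i, IsZetaPart K (fun m => centeredTerm A n (e i) (m + r i))
      (∑ a ∈ I, c (e i) a • invPow 0 a) := by
    intro e he i
    have hsub : (c (e i)).support ⊆ I :=
      subset_biUnion_of_mem (fun e => (c e).support)
        (mem_range.2 (by have := hexp he i; omega))
    rw [← sum_subset hsub fun a _ ha => by rw [Finsupp.notMem_support_iff.1 ha, zero_smul]]
    exact (hc _ (hexp he i)).shift (r i)
  obtain ⟨z, hz, hlim⟩ := tendsto_sum_nested_prod Q.support Q.coeff
    (fun i e m => centeredTerm A n e (m + r i)) I hI (fun e => c e) hf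
  simp_rw [hR] at ht
  exact ⟨z, hz, I, fun s => (∑ e ∈ Q.support, Q.coeff e * ∏ i, c (e i) (s i)) / p, hI,
    (tendsto_nhds_unique ht hlim).trans <| congrArg (z + ·) <| sum_eq_sum_cyclic hp I _
      (fun s => sum_coeff_mul_prod_comp hξ hQ (fun e => c e) s) fun s => (mzv (List.ofFn s) : ℂ)⟩

end

theorem statement17 (p : ℕ) (hp : 0 < p) (A n : ℕ) (r : ℕ → ℕ)
    (ξ : ℂ) (hξ0 : ξ ≠ 0) (hξ : ξ ^ p = 1)
    (P : MvPolynomial (Fin p) (Subfield.closure {ξ}))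
    (h9 : ∀ j : Fin p, (∑ i ∈ Finset.Iic j, P.degreeOf i) + j.1 + 2 ≤
      (j.1 + 1) * (A * (n + 1)))
    (hcyc : ∀ k : Fin p → ℂ,
      MvPolynomial.eval₂ (Subfield.closure {ξ}).subtype
          (fun i => (k (finRotate p i) + (r (finRotate p i).1 : ℂ) + (n : ℂ) / 2)
            - (r i.1 : ℂ) - (n : ℂ) / 2) P
        = ξ * MvPolynomial.eval₂ (Subfield.closure {ξ}).subtype k P) :
    Summable (fun k : {k : Fin p → ℕ // Antitone k ∧ ∀ i, 1 ≤ k i} =>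
        Rfun p (Subfield.closure {ξ}) (fun _ => A) (fun _ => n) r P
          (fun i => (k.1 i : ℂ))) ∧
    ∃ (Tlow : Finset (List ℕ)) (c : List ℕ → Subfield.closure {ξ})
      (T : Finset (Fin p → ℕ)) (μ : (Fin p → ℕ) → Subfield.closure {ξ}),
      (∀ s ∈ Tlow, s.length < p ∧ (∀ a ∈ s, 1 ≤ a) ∧ (s ≠ [] → 2 ≤ s.headI)) ∧
      (∀ s ∈ T, ∀ i : Fin p, 2 ≤ s i) ∧
      (∑' k : {k : Fin p → ℕ // Antitone k ∧ ∀ i, 1 ≤ k i},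
          Rfun p (Subfield.closure {ξ}) (fun _ => A) (fun _ => n) r P
            (fun i => (k.1 i : ℂ)))
        = (∑ s ∈ Tlow, (c s : ℂ) * (mzv s : ℂ)) +
          ∑ s ∈ T, (μ s : ℂ) *
            ∑ t ∈ Finset.range p,
              ξ ^ t * (mzv (List.ofFn fun j : Fin p => s ((finRotate p ^ t) j)) : ℂ) := by
  let ζ : Subfield.closure {ξ} := ⟨ξ, Subfield.subset_closure rfl⟩
  have hζ : ζ ≠ 0 := fun h => hξ0 (congrArg Subtype.val h)
  have hQ : MvPolynomial.rename (finRotate p) (translateVars (centerShift (Subfield.closure {ξ}) p n r) P) =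
      MvPolynomial.C ζ * translateVars (centerShift (Subfield.closure {ξ}) p n r) P := by
    refine rename_translateVars_eq fun k => ?_
    rw [← hcyc k]
    congr 1
    ext i
    simp only [coe_centerShift]
    ring
  have hdeg : ∀ i, (translateVars (centerShift (Subfield.closure {ξ}) p n r) P).degreeOf i + 2 ≤ A * (n + 1) := by
    intro i
    rw [degreeOf_eq_of_rename_eq hp hζ hQ i]
    have h0 := h9 ⟨0, hp⟩
    have h1 : Finset.Iic (⟨0, hp⟩ : Fin p) = {⟨0, hp⟩} := by
      ext j
      simp [Fin.le_def, Fin.ext_iff]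
    rw [h1, Finset.sum_singleton] at h0
    have h2 := degreeOf_translateVars_le (centerShift (Subfield.closure {ξ}) p n r) P ⟨0, hp⟩
    simp only [zero_add, one_mul, add_zero] at h0
    omega
  obtain ⟨hs, z, hz, I, μ, hI, h⟩ := summable_and_exists_cyclic hp r hζ hdeg hQ
    (fun k => Rfun p (Subfield.closure {ξ}) (fun _ => A) (fun _ => n) r P fun i => (k i : ℂ)) (Rfun_eq_sum r P)
  obtain ⟨Tlow, c, hT, rfl⟩ := exists_finset_of_mem_mzvSpan hz
  refine ⟨hs, Tlow, c, Fintype.piFinset fun _ => I, μ, fun s hs => ?_, fun s hs i => ?_, h⟩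
  · obtain ⟨h1, h2⟩ := hT s hs
    refine ⟨h1, fun a ha => one_le_two.trans (h2 a ha), fun hne => ?_⟩
    obtain ⟨a, s, rfl⟩ := List.exists_cons_of_ne_nil hne
    exact h2 a (by simp)
  · exact hI _ (Fintype.mem_piFinset.1 hs i)
end

section
/- Let A ≥ 2 and n ≥ 0 be integers, e ∈ {0, 1}, and let P ∈ ℚ[k] be a polynomial with deg P ≤ A(n+1) − 2 satisfying P(−k − n) = (−1)^{A(n+1)+e} P(k). Then the series Σ_{k ≥ 1} P(k)/((k)_{n+1})^A converges and is a ℚ-linear combination of 1 and the values ζ(s) with 2 ≤ s ≤ A and s ≡ e (mod 2). -/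
/-- The value `ζ(s) = ∑_{k ≥ 1} 1/k^s` of the Riemann zeta function. -/
noncomputable def zv (s : ℕ) : ℝ := ∑' k : ℕ+, ((k : ℝ) ^ s)⁻¹

open Finset in
theorem ascPochhammer_eval_eq_prod_range {R : Type*} [CommSemiring R] (n : ℕ) (x : R) :
    (ascPochhammer R n).eval x = ∏ i ∈ range n, (x + i) := by
  induction n with
  | zero => simp
  | succ n ih => rw [ascPochhammer_succ_eval, ih, prod_range_succ]

open Polynomial Finset in
/-- The numerator of `1 / (X + j) ^ (A - s)` over the common denominator `∏ i ≤ n, (X + i) ^ A`. -/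
noncomputable def partialNumerator (A n j s : ℕ) : ℚ[X] :=
  (X + C (j : ℚ)) ^ s * ∏ i ∈ (range (n + 1)).erase j, (X + C (i : ℚ)) ^ A

open Polynomial Finset in
theorem partialNumerator_monic (A n j s : ℕ) : (partialNumerator A n j s).Monic :=
  ((monic_X_add_C _).pow _).mul (monic_prod_of_monic _ _ fun _ _ => (monic_X_add_C _).pow _)

open Polynomial Finset in
theorem natDegree_partialNumerator {A n j : ℕ} (hj : j ∈ range (n + 1)) (s : ℕ) :
    (partialNumerator A n j s).natDegree = s + n * A := by
  rw [partialNumerator, Monic.natDegree_mul ((monic_X_add_C _).pow _)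
    (monic_prod_of_monic _ _ fun _ _ => (monic_X_add_C _).pow _),
    natDegree_prod_of_monic _ _ fun _ _ => (monic_X_add_C _).pow _]
  simp_rw [natDegree_pow, natDegree_X_add_C]
  simp [card_erase_of_mem hj, -mem_range]

open Polynomial Finset in
theorem exists_eq_sum_partialNumerator (A n : ℕ) (P : ℚ[X]) (hP : P.natDegree < A * (n + 1)) :
    ∃ c : ℕ → ℕ → ℚ, P = ∑ j ∈ range (n + 1), ∑ s ∈ range A,
      C (c j s) * partialNumerator A n j s := by
  have hcop : Set.Pairwise (range (n + 1) : Set ℕ)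
      fun i j => IsCoprime (X + C (i : ℚ)) (X + C (j : ℚ)) := by
    intro i _ j _ hij
    have h : IsUnit (-(i : ℚ) - -(j : ℚ)) := by
      rw [isUnit_iff_ne_zero]
      intro h
      exact hij (by exact_mod_cast (by linarith : (i : ℚ) = j))
    simpa using isCoprime_X_sub_C_of_isUnit_sub h
  obtain ⟨q, r, hr, hPr⟩ := eq_quo_mul_prod_pow_add_sum_rem_mul_prod_pow P
    (g := fun i : ℕ => X + C (i : ℚ)) (fun i _ => monic_X_add_C (i : ℚ)) hcop (fun _ => A)
  set D : ℚ[X] := ∏ i ∈ range (n + 1), (X + C (i : ℚ)) ^ A with hD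
  have hDm : D.Monic := monic_prod_of_monic _ _ fun _ _ => (monic_X_add_C _).pow _
  have hDdeg : D.degree = (A * (n + 1) : ℕ) := by
    rw [degree_eq_natDegree hDm.ne_zero, hD,
      natDegree_prod_of_monic _ _ fun _ _ => (monic_X_add_C _).pow _]
    simp_rw [natDegree_pow, natDegree_X_add_C]
    simp [mul_comm]
  let c : ℕ → ℕ → ℚ := fun j s => if h : s < A then (r j ⟨s, h⟩).coeff 0 else 0
  have hsum : ∑ i ∈ range (n + 1), ∑ j : Fin A, r i j * (X + C (i : ℚ)) ^ j.1 *
      ∏ k ∈ (range (n + 1)).erase i, (X + C (k : ℚ)) ^ A =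
      ∑ j ∈ range (n + 1), ∑ s ∈ range A, C (c j s) * partialNumerator A n j s := by
    refine sum_congr rfl fun i hi => ?_
    rw [sum_range]
    refine sum_congr rfl fun j _ => ?_
    have hdeg : (r i j).degree ≤ 0 := by
      have := hr i hi j
      rw [degree_X_add_C] at this
      exact Order.le_of_lt_succ this
    rw [partialNumerator, ← mul_assoc]
    congr 2
    simpa [c] using eq_C_of_degree_le_zero hdeg
  rw [hsum] at hPr
  have hlt : (∑ j ∈ range (n + 1), ∑ s ∈ range A,
      C (c j s) * partialNumerator A n j s).degree < D.degree := by
    have hbot : (⊥ : WithBot ℕ) < D.degree := by rw [hDdeg]; exact WithBot.bot_lt_coe _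
    refine (degree_sum_le _ _).trans_lt ((Finset.sup_lt_iff hbot).2 fun j hj => ?_)
    refine (degree_sum_le _ _).trans_lt ((Finset.sup_lt_iff hbot).2 fun s hs => ?_)
    rw [← smul_eq_C_mul]
    refine (degree_smul_le _ _).trans_lt ?_
    rw [degree_eq_natDegree (partialNumerator_monic _ _ _ _).ne_zero,
      natDegree_partialNumerator hj, hDdeg]
    have := mem_range.1 hs
    exact_mod_cast (by nlinarith : s + n * A < A * (n + 1))
  refine ⟨c, ?_⟩
  have hPlt : P.degree < D.degree := by
    rw [hDdeg]
    exact degree_le_natDegree.trans_lt (by exact_mod_cast hP)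
  have hq : q = 0 := by
    have h := (div_modByMonic_unique (f := P) q _ hDm
      ⟨by rw [add_comm, mul_comm]; exact hPr.symm, hlt⟩).1
    exact h.symm.trans ((divByMonic_eq_zero_iff hDm).2 hPlt)
  simpa [hq] using hPr

open Polynomial Finset in
/-- Partial fraction expansion of `P(x) / ((x)_{n+1})^A`; the residues sum to zero
when the degree of the fraction is at most `-2`. -/
theorem exists_partial_fractions (A n : ℕ) (hA : 1 ≤ A) (P : ℚ[X])
    (hP : P.natDegree + 2 ≤ A * (n + 1)) :
    ∃ c : ℕ → ℕ → ℚ, ∑ j ∈ range (n + 1), c j 1 = 0 ∧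
      ∀ x : ℚ, (∀ j ∈ range (n + 1), x + j ≠ 0) →
        P.eval x / ((ascPochhammer ℚ (n + 1)).eval x) ^ A =
          ∑ j ∈ range (n + 1), ∑ s ∈ Icc 1 A, c j s / (x + j) ^ s := by
  obtain ⟨c, hc⟩ := exists_eq_sum_partialNumerator A n P (by omega)
  refine ⟨fun j s => c j (A - s), ?_, fun x hx => ?_⟩
  · have h0 : P.coeff (A - 1 + n * A) = 0 :=
      coeff_eq_zero_of_natDegree_lt (by
        have : A * (n + 1) = n * A + A := by ring
        omega)
    rw [hc] at h0
    simp only [finsetSum_coeff, coeff_C_mul] at h0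
    rw [← h0]
    refine sum_congr rfl fun j hj => ?_
    rw [sum_eq_single (A - 1)]
    · have h := (partialNumerator_monic A n j (A - 1)).coeff_natDegree
      rw [natDegree_partialNumerator hj] at h
      rw [h, mul_one]
    · intro s hs hsA
      rw [coeff_eq_zero_of_natDegree_lt, mul_zero]
      rw [natDegree_partialNumerator hj]
      have := mem_range.1 hs
      omega
    · intro h
      exact absurd (mem_range.2 (by omega)) h
  · conv_lhs => rw [hc]
    rw [eval_finsetSum, sum_div]
    refine sum_congr rfl fun j hj => ?_
    rw [eval_finsetSum, sum_div]
    have hpoch : ((ascPochhammer ℚ (n + 1)).eval x) ^ A =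
        (x + j) ^ A * ∏ i ∈ (range (n + 1)).erase j, (x + i) ^ A := by
      rw [ascPochhammer_eval_eq_prod_range, ← prod_pow]
      exact (mul_prod_erase _ (fun i : ℕ => (x + i) ^ A) hj).symm
    have hne : ∏ i ∈ (range (n + 1)).erase j, (x + i) ^ A ≠ 0 :=
      prod_ne_zero_iff.2 fun i hi => pow_ne_zero _ (hx i (mem_of_mem_erase hi))
    have hxj := hx j hj
    refine sum_nbij' (fun s => A - s) (fun s => A - s) ?_ ?_ ?_ ?_ ?_
    · intro s hs; simp only [mem_range, mem_Icc] at *; omega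
    · intro s hs; simp only [mem_range, mem_Icc] at *; omega
    · intro s hs; simp only [mem_range] at *; omega
    · intro s hs; simp only [mem_Icc] at *; omega
    · intro s hs
      have hs' := mem_range.1 hs
      have hsplit : (x + j) ^ A = (x + j) ^ s * (x + j) ^ (A - s) := by
        rw [← pow_add]; congr 1; omega
      rw [hpoch, hsplit, partialNumerator]
      simp only [eval_mul, eval_C, eval_pow, eval_add, eval_X, eval_prod]
      rw [show A - (A - s) = s by omega]
      field_simp

open Polynomial Finset in
/-- A symmetry of the fraction forces the partial fraction coefficients, summed over the poles,
to vanish at every order of the wrong parity. -/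
theorem exists_partial_fractions_of_symm (A n e : ℕ) (hA : 1 ≤ A) (P : ℚ[X])
    (hP : P.natDegree + 2 ≤ A * (n + 1))
    (hsym : ∀ x : ℚ, P.eval (-x - (n : ℚ)) = (-1 : ℚ) ^ (A * (n + 1) + e) * P.eval x) :
    ∃ c : ℕ → ℕ → ℚ, ∑ j ∈ range (n + 1), c j 1 = 0 ∧
      (∀ s, s % 2 ≠ e % 2 → ∑ j ∈ range (n + 1), c j s = 0) ∧
      ∀ x : ℚ, 0 < x →
        P.eval x / ((ascPochhammer ℚ (n + 1)).eval x) ^ A =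
          ∑ j ∈ range (n + 1), ∑ s ∈ Icc 1 A, c j s / (x + j) ^ s := by
  obtain ⟨c, hc1, hc⟩ := exists_partial_fractions A n hA P hP
  have hsum : ∀ s, ∑ j ∈ range (n + 1), (c j s + (-1) ^ (e + s) * c (n - j) s) / 2 =
      (1 + (-1) ^ (e + s)) / 2 * ∑ j ∈ range (n + 1), c j s := by
    intro s
    have h := sum_range_reflect (fun j => c j s) (n + 1)
    simp only [Nat.add_sub_cancel] at h
    rw [← sum_div, sum_add_distrib, ← mul_sum, h]
    ring
  refine ⟨fun j s => (c j s + (-1) ^ (e + s) * c (n - j) s) / 2, ?_, ?_, ?_⟩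
  · rw [hsum, hc1, mul_zero]
  · intro s hs
    have hodd : Odd (e + s) := by rw [Nat.odd_iff]; omega
    rw [hsum, hodd.neg_one_pow]
    ring
  · intro x hx
    have h1 := hc x fun j _ => by positivity
    have h2 := hc (-x - n) fun j hj h => by
      have : (j : ℚ) ≤ n := by exact_mod_cast Nat.lt_succ_iff.1 (mem_range.1 hj)
      linarith
    have hpoch : (ascPochhammer ℚ (n + 1)).eval (-x - (n : ℚ)) =
        (-1) ^ (n + 1) * (ascPochhammer ℚ (n + 1)).eval x := by
      rw [ascPochhammer_eval_eq_prod_range, ascPochhammer_eval_eq_prod_range,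
        ← prod_range_reflect, show (-1 : ℚ) ^ (n + 1) = ∏ _j ∈ range (n + 1), -1 by simp,
        ← prod_mul_distrib]
      refine prod_congr rfl fun j hj => ?_
      rw [Nat.add_sub_cancel, Nat.cast_sub (Nat.lt_succ_iff.1 (mem_range.1 hj))]
      ring
    have hsgn : ∀ m : ℕ, ((-1 : ℚ) ^ m) * (-1) ^ m = 1 := fun m => by
      rw [← mul_pow]; norm_num
    have hflip : P.eval (-x - (n : ℚ)) / ((ascPochhammer ℚ (n + 1)).eval (-x - (n : ℚ))) ^ A =
        (-1) ^ e * (P.eval x / ((ascPochhammer ℚ (n + 1)).eval x) ^ A) := by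
      rw [hsym, hpoch, mul_pow, ← pow_mul, mul_comm (n + 1) A, pow_add, mul_assoc,
        mul_div_mul_left _ _ (pow_ne_zero _ (by norm_num)), mul_div_assoc]
    have h3 : P.eval x / ((ascPochhammer ℚ (n + 1)).eval x) ^ A =
        ∑ j ∈ range (n + 1), ∑ s ∈ Icc 1 A, (-1) ^ (e + s) * c (n - j) s / (x + j) ^ s := by
      have h4 : P.eval x / ((ascPochhammer ℚ (n + 1)).eval x) ^ A =
          (-1) ^ e * ∑ j ∈ range (n + 1), ∑ s ∈ Icc 1 A, c j s / (-x - n + j) ^ s := by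
        rw [← h2, hflip, ← mul_assoc, hsgn, one_mul]
      rw [h4, ← sum_range_reflect, mul_sum]
      refine sum_congr rfl fun j hj => ?_
      rw [mul_sum]
      refine sum_congr rfl fun s _ => ?_
      rw [Nat.add_sub_cancel, Nat.cast_sub (Nat.lt_succ_iff.1 (mem_range.1 hj)),
        show (-x - n + ((n : ℚ) - j)) = (-1) * (x + j) by ring, mul_pow, pow_add]
      have hxj : (x + j) ^ s ≠ 0 := by positivity
      have h1s : ((-1 : ℚ) ^ s) ≠ 0 := pow_ne_zero _ (by norm_num)
      field_simp
      rw [sq, hsgn, mul_one]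
    have h5 : P.eval x / ((ascPochhammer ℚ (n + 1)).eval x) ^ A =
        (P.eval x / ((ascPochhammer ℚ (n + 1)).eval x) ^ A +
          P.eval x / ((ascPochhammer ℚ (n + 1)).eval x) ^ A) / 2 := by ring
    rw [h5]
    nth_rewrite 1 [h1]
    rw [h3, ← sum_add_distrib, sum_div]
    refine sum_congr rfl fun j _ => ?_
    rw [← sum_add_distrib, sum_div]
    refine sum_congr rfl fun s _ => ?_
    ring

open Finset Filter Topology in
theorem hasSum_inv_pow_shift_sub (j : ℕ) {s : ℕ} (hs : 1 ≤ s) :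
    HasSum (fun k : ℕ+ => (((k : ℝ) + j) ^ s)⁻¹ - ((k : ℝ) ^ s)⁻¹)
      (-∑ m ∈ range j, (((m : ℝ) + 1) ^ s)⁻¹) := by
  induction j with
  | zero => simp
  | succ j ih =>
    let f : ℕ → ℝ := fun k => (((k : ℝ) + 1 + j) ^ s)⁻¹
    have hf : Tendsto f atTop (𝓝 0) := by
      refine tendsto_inv_atTop_zero.comp ((tendsto_pow_atTop (by omega)).comp ?_)
      exact tendsto_atTop_add_const_right _ _
        (tendsto_atTop_add_const_right _ _ tendsto_natCast_atTop_atTop)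
    have hstep : HasSum (fun k : ℕ => f k - f (k + 1)) (f 0) := by
      rw [hasSum_iff_tendsto_nat_of_nonneg]
      · simp_rw [sum_range_sub']
        simpa using hf.const_sub (f 0)
      · intro k
        rw [sub_nonneg]
        simp only [f]
        gcongr
        linarith
    have hstep' : HasSum (fun k : ℕ+ => (((k : ℝ) + j) ^ s)⁻¹ - (((k : ℝ) + (j + 1 : ℕ)) ^ s)⁻¹)
        (f 0) := by
      rw [← Equiv.pnatEquivNat.symm.hasSum_iff]
      convert hstep using 2 with k
      simp [f]
      ring
    have hval : -∑ m ∈ range (j + 1), (((m : ℝ) + 1) ^ s)⁻¹ =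
        -∑ m ∈ range j, (((m : ℝ) + 1) ^ s)⁻¹ - f 0 := by
      simp only [f, sum_range_succ, Nat.cast_zero, zero_add]
      ring
    rw [hval]
    have hterm : ∀ k : ℕ+, (((k : ℝ) + (j + 1 : ℕ)) ^ s)⁻¹ - ((k : ℝ) ^ s)⁻¹ =
        ((((k : ℝ) + j) ^ s)⁻¹ - ((k : ℝ) ^ s)⁻¹) -
          ((((k : ℝ) + j) ^ s)⁻¹ - (((k : ℝ) + (j + 1 : ℕ)) ^ s)⁻¹) := fun k => by ring
    simp_rw [hterm]
    exact ih.sub hstep'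

theorem hasSum_zv {s : ℕ} (hs : 2 ≤ s) : HasSum (fun k : ℕ+ => ((k : ℝ) ^ s)⁻¹) (zv s) :=
  ((Real.summable_nat_pow_inv.2 (by omega)).comp_injective PNat.coe_injective).hasSum

open Finset in
theorem hasSum_partial_fractions (A n : ℕ) (hA : 1 ≤ A) (c : ℕ → ℕ → ℚ)
    (hc : ∑ j ∈ range (n + 1), c j 1 = 0) :
    HasSum (fun k : ℕ+ => ∑ j ∈ range (n + 1), ∑ s ∈ Icc 1 A, (c j s : ℝ) / ((k : ℝ) + j) ^ s)
      (((-∑ j ∈ range (n + 1), ∑ s ∈ Icc 1 A, c j s * ∑ m ∈ range j, (((m : ℚ) + 1) ^ s)⁻¹ : ℚ) : ℝ)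
        + ∑ s ∈ Icc 2 A, ((∑ j ∈ range (n + 1), c j s : ℚ) : ℝ) * zv s) := by
  have h1 : HasSum (fun k : ℕ+ => ∑ j ∈ range (n + 1), ∑ s ∈ Icc 1 A,
      (c j s : ℝ) * ((((k : ℝ) + j) ^ s)⁻¹ - ((k : ℝ) ^ s)⁻¹))
      (∑ j ∈ range (n + 1), ∑ s ∈ Icc 1 A,
        (c j s : ℝ) * (-∑ m ∈ range j, (((m : ℝ) + 1) ^ s)⁻¹)) :=
    hasSum_sum fun j _ => hasSum_sum fun s hs =>
      (hasSum_inv_pow_shift_sub j (mem_Icc.1 hs).1).mul_left _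
  have h2 : HasSum (fun k : ℕ+ => ∑ s ∈ Icc 2 A,
      ((∑ j ∈ range (n + 1), c j s : ℚ) : ℝ) * ((k : ℝ) ^ s)⁻¹)
      (∑ s ∈ Icc 2 A, ((∑ j ∈ range (n + 1), c j s : ℚ) : ℝ) * zv s) :=
    hasSum_sum fun s hs => (hasSum_zv (mem_Icc.1 hs).1).mul_left _
  convert h1.add h2 using 1
  · ext k
    have h3 : ∑ s ∈ Icc 2 A, ((∑ j ∈ range (n + 1), c j s : ℚ) : ℝ) * ((k : ℝ) ^ s)⁻¹ =
        ∑ j ∈ range (n + 1), ∑ s ∈ Icc 1 A, (c j s : ℝ) * ((k : ℝ) ^ s)⁻¹ := by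
      rw [sum_comm, ← add_sum_Ioc_eq_sum_Icc hA, ← sum_mul]
      have h4 : ∑ j ∈ range (n + 1), (c j 1 : ℝ) = 0 := by exact_mod_cast hc
      rw [h4, zero_mul, zero_add]
      refine sum_congr (by ext; simp; omega) fun s _ => ?_
      rw [← sum_mul]
      push_cast
      rfl
    rw [h3, ← sum_add_distrib]
    refine sum_congr rfl fun j _ => ?_
    rw [← sum_add_distrib]
    refine sum_congr rfl fun s _ => ?_
    ring
  · push_cast
    simp only [mul_neg, sum_neg_distrib]

theorem statement19 (A n e : ℕ) (hA : 2 ≤ A) (he : e ≤ 1) (P : Polynomial ℚ)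
    (hdeg : P.natDegree + 2 ≤ A * (n + 1))
    (hsym : ∀ x : ℚ, P.eval (-x - (n : ℚ)) = (-1 : ℚ) ^ (A * (n + 1) + e) * P.eval x) :
    Summable (fun k : ℕ+ =>
        (Polynomial.aeval (k : ℝ)) P / ((ascPochhammer ℝ (n + 1)).eval (k : ℝ)) ^ A) ∧
    ∃ (c₀ : ℚ) (c : ℕ → ℚ),
      (∑' k : ℕ+,
          (Polynomial.aeval (k : ℝ)) P / ((ascPochhammer ℝ (n + 1)).eval (k : ℝ)) ^ A)
        = c₀ + ∑ s ∈ (Finset.Icc 2 A).filter (fun s => s % 2 = e % 2),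
            (c s : ℝ) * zv s := by
  obtain ⟨c, hc1, hcpar, hc⟩ := exists_partial_fractions_of_symm A n e (by omega) P hdeg hsym
  have hsum := hasSum_partial_fractions A n (by omega) c hc1
  have hterm : (fun k : ℕ+ =>
      (Polynomial.aeval (k : ℝ)) P / ((ascPochhammer ℝ (n + 1)).eval (k : ℝ)) ^ A) =
      fun k : ℕ+ => ∑ j ∈ Finset.range (n + 1), ∑ s ∈ Finset.Icc 1 A,
        (c j s : ℝ) / ((k : ℝ) + j) ^ s := by
    ext k
    have h := congrArg (Rat.cast : ℚ → ℝ) (hc (k : ℕ) (by exact_mod_cast k.pos))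
    have hP : Polynomial.aeval ((k : ℕ) : ℝ) P = ((P.eval ((k : ℕ) : ℚ) : ℚ) : ℝ) := by
      simpa using Polynomial.aeval_algebraMap_apply_eq_algebraMap_eval (A := ℝ) ((k : ℕ) : ℚ) P
    rw [ascPochhammer_eval_eq_prod_range] at h ⊢
    push_cast at h
    rw [hP, h]
  rw [← hterm] at hsum
  refine ⟨hsum.summable, _, fun s => ∑ j ∈ Finset.range (n + 1), c j s,
    hsum.tsum_eq.trans (congrArg _ (Eq.symm ?_))⟩
  refine Finset.sum_filter_of_ne fun s _ hne => ?_
  by_contra hpar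
  exact hne (by simp only [hcpar s hpar, Rat.cast_zero, zero_mul])
end
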